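/- Let P be a distribution on {0,1}^n, and let P' = (π₁P) ⊗ ⋯ ⊗ (πₙP) be the product of the marginals of P (πᵢP denotes the marginal of P on coordinate i). Then, letting Q range over all product distributions on {0,1}^n, min_Q d_H(P,Q) ≥ (1/(1+√n))·d_H(P,P'). -/

import Mathlib

open Finset

/-- `P` is a probability distribution on `{0,1}^n`. -/
def IsDist {n : ℕ} (P : (Fin n → Bool) → ℝ) : Prop :=
  (∀ x, 0 ≤ P x) ∧ ∑ x : Fin n → Bool, P x = 1

/-- The marginal of `P` on coordinate `i`. -/
noncomputable def marginal {n : ℕ} (P : (Fin n → Bool) → ℝ) (i : Fin n) (b : Bool) : ℝ :=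
  ∑ x : Fin n → Bool, if x i = b then P x else 0

/-- `P` is a product distribution: it equals the product of its marginals. -/
def IsProduct {n : ℕ} (P : (Fin n → Bool) → ℝ) : Prop :=
  ∀ x, P x = ∏ i, marginal P i (x i)

/-- Total variation distance between `P` and `Q`. -/
noncomputable def tvDist {n : ℕ} (P Q : (Fin n → Bool) → ℝ) : ℝ :=
  (1 / 2) * ∑ x : Fin n → Bool, |P x - Q x|

/-- Hellinger distance between `P` and `Q`. -/
noncomputable def hellinger {n : ℕ} (P Q : (Fin n → Bool) → ℝ) : ℝ :=
  (1 / Real.sqrt 2) *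
    Real.sqrt (∑ x : Fin n → Bool, (Real.sqrt (P x) - Real.sqrt (Q x)) ^ 2)

/-- `P` is Markov with respect to some DAG on `[n]` of in-degree at most `d`:
there are parent sets `par i` of size at most `d`, acyclic (witnessed by a rank function),
and conditional probability kernels `f i` (depending only on the parents' values)
such that `P` factorizes accordingly. -/
def IsBayesNet {n : ℕ} (d : ℕ) (P : (Fin n → Bool) → ℝ) : Prop :=
  ∃ (par : Fin n → Finset (Fin n)) (rank : Fin n → ℕ)
    (f : Fin n → Bool → (Fin n → Bool) → ℝ),
    (∀ i, (par i).card ≤ d) ∧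
    (∀ i, ∀ j ∈ par i, rank j < rank i) ∧
    (∀ i b x, 0 ≤ f i b x) ∧
    (∀ i x, f i false x + f i true x = 1) ∧
    (∀ i b x y, (∀ j ∈ par i, x j = y j) → f i b x = f i b y) ∧
    (∀ x, P x = ∏ i, f i (x i) x)

/-- Probability that the `m`-sample tester `T` accepts (outputs `true`),
when its input consists of `m` i.i.d. samples from `P`. -/
noncomputable def acceptProb {n m : ℕ} (P : (Fin n → Bool) → ℝ)
    (T : (Fin m → Fin n → Bool) → Bool) : ℝ :=
  ∑ s : Fin m → Fin n → Bool, if T s then ∏ k, P (s k) else 0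

/-- The product of the marginals of `P`. -/
noncomputable def prodMarginals {n : ℕ} (P : (Fin n → Bool) → ℝ) : (Fin n → Bool) → ℝ :=
  fun x => ∏ i, marginal P i (x i)

/-- The Bhattacharyya coefficient of two nonnegative functions on a finite type. -/
noncomputable def bhattacharyya {α : Type*} [Fintype α] (p q : α → ℝ) : ℝ :=
  ∑ a, √(p a) * √(q a)

theorem bhattacharyya_nonneg {α : Type*} [Fintype α] (p q : α → ℝ) : 0 ≤ bhattacharyya p q :=
  Finset.sum_nonneg fun _ _ => by positivity

theorem sum_sq_sqrt_sub_sqrt {α : Type*} [Fintype α] {p q : α → ℝ} (hp : ∀ a, 0 ≤ p a)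
    (hq : ∀ a, 0 ≤ q a) (hp1 : ∑ a, p a = 1) (hq1 : ∑ a, q a = 1) :
    ∑ a, (√(p a) - √(q a)) ^ 2 = 2 * (1 - bhattacharyya p q) := by
  have h : ∀ a, (√(p a) - √(q a)) ^ 2 = p a + q a - 2 * (√(p a) * √(q a)) := fun a => by
    rw [sub_sq, Real.sq_sqrt (hp a), Real.sq_sqrt (hq a)]; ring
  simp only [h, Finset.sum_sub_distrib, Finset.sum_add_distrib, ← Finset.mul_sum, hp1, hq1,
    bhattacharyya]
  ring

theorem hellinger_triangle {n : ℕ} (P Q R : (Fin n → Bool) → ℝ) :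
    hellinger P R ≤ hellinger P Q + hellinger Q R := by
  have h := dist_triangle (WithLp.toLp 2 fun x => √(P x) : EuclideanSpace ℝ (Fin n → Bool))
    (WithLp.toLp 2 fun x => √(Q x)) (WithLp.toLp 2 fun x => √(R x))
  simp only [EuclideanSpace.dist_eq, Real.dist_eq, sq_abs] at h
  unfold hellinger
  rw [← mul_add]
  exact mul_le_mul_of_nonneg_left h (by positivity)

theorem hellinger_eq_sqrt {n : ℕ} {P Q : (Fin n → Bool) → ℝ} (hP : IsDist P) (hQ : IsDist Q) :
    hellinger P Q = √(1 - bhattacharyya P Q) := by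
  rw [hellinger, sum_sq_sqrt_sub_sqrt hP.1 hQ.1 hP.2 hQ.2, Real.sqrt_mul zero_le_two,
    one_div, inv_mul_cancel_left₀ (by positivity)]

theorem marginal_nonneg {n : ℕ} {P : (Fin n → Bool) → ℝ} (hP : IsDist P) (i : Fin n) (b : Bool) :
    0 ≤ marginal P i b :=
  Finset.sum_nonneg fun x _ => by split_ifs; exacts [hP.1 x, le_rfl]

theorem sum_marginal {n : ℕ} {P : (Fin n → Bool) → ℝ} (hP : IsDist P) (i : Fin n) :
    ∑ b, marginal P i b = 1 := by
  unfold marginal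
  rw [Finset.sum_comm]
  simpa using hP.2

theorem isDist_prodMarginals {n : ℕ} {P : (Fin n → Bool) → ℝ} (hP : IsDist P) :
    IsDist (prodMarginals P) := by
  refine ⟨fun x => Finset.prod_nonneg fun i _ => marginal_nonneg hP i _, ?_⟩
  simp only [prodMarginals]
  rw [← Fintype.prod_sum]
  simp only [sum_marginal hP, Finset.prod_const_one]

/-- Data processing: passing to a marginal does not decrease the Bhattacharyya coefficient. -/
theorem bhattacharyya_le_marginal {n : ℕ} {P Q : (Fin n → Bool) → ℝ} (hP : IsDist P)
    (hQ : IsDist Q) (i : Fin n) :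
    bhattacharyya P Q ≤ bhattacharyya (marginal P i) (marginal Q i) := by
  have h : bhattacharyya P Q = ∑ b, ∑ x with x i = b, √(P x) * √(Q x) :=
    (Finset.sum_fiberwise _ _ _).symm
  rw [h]
  refine Finset.sum_le_sum fun b _ => ?_
  simp only [marginal, ← Finset.sum_filter]
  exact Real.sum_sqrt_mul_sqrt_le _ hP.1 hQ.1

theorem bhattacharyya_prodMarginals {n : ℕ} {P Q : (Fin n → Bool) → ℝ} (hP : IsDist P)
    (hQ : IsDist Q) :
    bhattacharyya (prodMarginals P) (prodMarginals Q) =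
      ∏ i, bhattacharyya (marginal P i) (marginal Q i) := by
  simp only [bhattacharyya, prodMarginals]
  rw [Fintype.prod_sum]
  refine Finset.sum_congr rfl fun x _ => ?_
  rw [Finset.prod_mul_distrib, Real.sqrt_prod _ fun i _ => marginal_nonneg hP i _,
    Real.sqrt_prod _ fun i _ => marginal_nonneg hQ i _]

theorem hellinger_prodMarginals_le {n : ℕ} {P Q : (Fin n → Bool) → ℝ} (hP : IsDist P)
    (hQ : IsDist Q) :
    hellinger (prodMarginals P) (prodMarginals Q) ≤ √n * hellinger P Q := by
  rw [hellinger_eq_sqrt hP hQ, hellinger_eq_sqrt (isDist_prodMarginals hP)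
    (isDist_prodMarginals hQ), ← Real.sqrt_mul (Nat.cast_nonneg n),
    bhattacharyya_prodMarginals hP hQ]
  refine Real.sqrt_le_sqrt ?_
  have bernoulli : 1 + (bhattacharyya P Q - 1) * n ≤ bhattacharyya P Q ^ n := by
    have := one_add_mul_le_pow (a := bhattacharyya P Q - 1)
      (by linarith [bhattacharyya_nonneg P Q]) n
    rw [add_sub_cancel] at this
    linarith
  have hprod : bhattacharyya P Q ^ n ≤ ∏ i, bhattacharyya (marginal P i) (marginal Q i) := by
    simpa using Finset.prod_le_prod (s := (Finset.univ : Finset (Fin n)))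
      (fun _ _ => bhattacharyya_nonneg P Q) fun i _ => bhattacharyya_le_marginal hP hQ i
  linarith

theorem hellinger_comm {n : ℕ} (P Q : (Fin n → Bool) → ℝ) : hellinger P Q = hellinger Q P := by
  simp only [hellinger, sub_sq_comm]

/-- The Hellinger distance from `P` to any product distribution `Q` is at least
`1/(1+√n)` times the Hellinger distance from `P` to the product of its marginals. -/
theorem hellinger_projection_lb_product (n : ℕ) (P : (Fin n → Bool) → ℝ) (hP : IsDist P) :
    ∀ Q : (Fin n → Bool) → ℝ, IsDist Q → IsProduct Q →
      (1 / (1 + Real.sqrt n)) * hellinger P (prodMarginals P) ≤ hellinger P Q := by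
  intro Q hQ hprod
  have hQ' : prodMarginals Q = Q := funext fun x => (hprod x).symm
  have h₁ := hellinger_triangle P Q (prodMarginals P)
  have h₂ := hellinger_prodMarginals_le hQ hP
  rw [hQ', hellinger_comm Q P] at h₂
  rw [one_div, inv_mul_le_iff₀ (by positivity)]
  linarith
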